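/- The ratio of weighted integrals satisfies ∫₀^{2π} ∫₀² e^{2·f(t,θ)}·w(t) dt dθ ≤ 200·e^{100} · ∫₀^{2π} ∫₀² e^{f(t,θ)}·w(t) dt dθ; that is, (∫_{S²} e^{2f} dvol_h) / (∫_{S²} e^{f} dvol_h) ≤ 200·e^{100}. -/

import Mathlib

open Set intervalIntegral

/-- A `C²` concave warping function on `[0, 2]` that is positive inside and vanishes at both
endpoints. -/
structure WarpingProfile (w : ℝ → ℝ) : Prop where
  contDiff : ContDiff ℝ 2 w
  concave : ConcaveOn ℝ (Icc 0 2) w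
  left_eq_zero : w 0 = 0
  right_eq_zero : w 2 = 0
  pos : ∀ t ∈ Ioo (0 : ℝ) 2, 0 < w t

/-- The gradient bound `g'² ≤ -w'' / w` on `(0, 2)`. -/
structure GradientBound (w g : ℝ → ℝ) : Prop where
  differentiable : Differentiable ℝ g
  sq_le : ∀ t ∈ Ioo (0 : ℝ) 2, deriv g t ^ 2 ≤ -deriv (deriv w) t / w t

theorem ConcaveOn.le_tangent {S : Set ℝ} {f : ℝ → ℝ} (hf : ConcaveOn ℝ S f)
    (hd : Differentiable ℝ f) {x y : ℝ} (hx : x ∈ S) (hy : y ∈ S) :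
    f y ≤ f x + deriv f x * (y - x) := by
  rcases lt_trichotomy x y with h | rfl | h
  · have := hf.slope_le_deriv hx hy h (hd x)
    rw [slope_def_field, div_le_iff₀ (by linarith)] at this
    linarith
  · simp
  · have := hf.deriv_le_slope hy hx h (hd x)
    rw [slope_def_field, le_div_iff₀ (by linarith)] at this
    linarith

namespace GradientBound

variable {w g : ℝ → ℝ}

theorem neg (hg : GradientBound w g) : GradientBound w (fun t => -g t) where
  differentiable := hg.differentiable.neg
  sq_le t ht := by
    have h : deriv (fun s => -g s) t = -deriv g t := deriv.fun_neg
    rw [h, neg_sq]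
    exact hg.sq_le t ht

theorem reflect (hg : GradientBound w g) :
    GradientBound (fun t => w (2 - t)) (fun t => g (2 - t)) where
  differentiable := hg.differentiable.comp (by fun_prop)
  sq_le t ht := by
    have h : deriv (fun s => w (2 - s)) = fun s => -deriv w (2 - s) :=
      funext fun s => deriv_comp_const_sub ..
    have h' : deriv (fun s => -deriv w (2 - s)) t = deriv (deriv w) (2 - t) := by
      rw [deriv.fun_neg, deriv_comp_const_sub, neg_neg]
    rw [h, h', deriv_comp_const_sub, neg_sq]
    exact hg.sq_le (2 - t) ⟨by linarith [ht.2], by linarith [ht.1]⟩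

theorem two_mul_abs_deriv_le (hg : GradientBound w g) {t : ℝ} (ht : t ∈ Ioo (0 : ℝ) 2) :
    |2 * (t * deriv g t)| ≤ -2 * (t ^ 2 * (deriv (deriv w) t / w t)) + 1 / 2 := by
  have h := mul_le_mul_of_nonneg_left (hg.sq_le t ht) (sq_nonneg t)
  rw [neg_div] at h
  rw [abs_le]
  constructor <;> nlinarith [sq_nonneg (t * deriv g t - 1 / 2), sq_nonneg (t * deriv g t + 1 / 2)]

end GradientBound

namespace WarpingProfile

variable {w g : ℝ → ℝ}

theorem reflect (hw : WarpingProfile w) : WarpingProfile (fun t => w (2 - t)) where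
  contDiff := hw.contDiff.comp (by fun_prop)
  concave := by
    refine ⟨convex_Icc 0 2, fun x hx y hy a b ha hb hab => ?_⟩
    have := hw.concave.2 (show 2 - x ∈ Icc 0 2 from ⟨by linarith [hx.2], by linarith [hx.1]⟩)
      (show 2 - y ∈ Icc 0 2 from ⟨by linarith [hy.2], by linarith [hy.1]⟩) ha hb hab
    simp only [smul_eq_mul] at this ⊢
    convert this using 2
    linear_combination (-2) * hab
  left_eq_zero := by simpa using hw.right_eq_zero
  right_eq_zero := by simpa using hw.left_eq_zero
  pos t ht := hw.pos _ ⟨by linarith [ht.2], by linarith [ht.1]⟩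

theorem differentiable (hw : WarpingProfile w) : Differentiable ℝ w :=
  hw.contDiff.differentiable (by norm_num)

theorem differentiable_deriv (hw : WarpingProfile w) : Differentiable ℝ (deriv w) := by
  have h : ContDiff ℝ (1 + 1) w := by simpa [one_add_one_eq_two] using hw.contDiff
  exact (contDiff_succ_iff_deriv.1 h).2.2.differentiable (by norm_num)

theorem mul_deriv_le (hw : WarpingProfile w) {t : ℝ} (ht : t ∈ Icc (0 : ℝ) 2) :
    t * deriv w t ≤ w t := by
  have := hw.concave.le_tangent hw.differentiable ht (y := 0) ⟨le_rfl, zero_le_two⟩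
  rw [hw.left_eq_zero] at this
  linarith

theorem neg_le_deriv_one (hw : WarpingProfile w) : -w 1 ≤ deriv w 1 := by
  have := hw.concave.le_tangent hw.differentiable (x := 1) (y := 2) (by norm_num) (by norm_num)
  rw [hw.right_eq_zero] at this
  linarith

theorem le_two_mul (hw : WarpingProfile w) {t : ℝ} (ht : t ∈ Icc (0 : ℝ) 1) :
    w t ≤ 2 * w 1 := by
  have h := hw.concave.le_tangent hw.differentiable (x := 1) (y := t) (by norm_num)
    ⟨ht.1, by linarith [ht.2]⟩
  nlinarith [hw.neg_le_deriv_one, hw.pos 1 (by norm_num), ht.1, ht.2]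

theorem mul_le (hw : WarpingProfile w) {t : ℝ} (ht : t ∈ Icc (0 : ℝ) 1) :
    t * w 1 ≤ w t := by
  have := hw.concave.2 (show (0 : ℝ) ∈ Icc 0 2 by norm_num) (show (1 : ℝ) ∈ Icc 0 2 by norm_num)
    (sub_nonneg.2 ht.2) ht.1 (sub_add_cancel 1 t)
  simpa [hw.left_eq_zero] using this

theorem logDeriv_le_one (hw : WarpingProfile w) {t : ℝ} (ht : t ∈ Ioc (0 : ℝ) 1) :
    t * deriv w t / w t ≤ 1 :=
  (div_le_one (hw.pos t ⟨ht.1, by linarith [ht.2]⟩)).2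
    (hw.mul_deriv_le ⟨ht.1.le, by linarith [ht.2]⟩)

theorem neg_one_le_logDeriv_one (hw : WarpingProfile w) : -1 ≤ 1 * deriv w 1 / w 1 := by
  rw [le_div_iff₀ (hw.pos 1 (by norm_num))]
  linarith [hw.neg_le_deriv_one]

/-- The logarithmic derivative `q = t w' / w` satisfies `t q' = q (1 - q) + t² w'' / w`. -/
theorem hasDerivAt_logDeriv (hw : WarpingProfile w) {t : ℝ} (ht : t ∈ Ioo (0 : ℝ) 2) :
    HasDerivAt (fun s => s * deriv w s / w s)
      ((t * deriv w t / w t * (1 - t * deriv w t / w t) + t ^ 2 * (deriv (deriv w) t / w t)) / t)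
      t := by
  have hwt := (hw.pos t ht).ne'
  have ht0 := ht.1.ne'
  refine (((hasDerivAt_id' t).fun_mul (hw.differentiable_deriv t).hasDerivAt).fun_div
    (hw.differentiable t).hasDerivAt hwt).congr_deriv ?_
  field_simp
  ring

theorem two_mul_le_add_log (hw : WarpingProfile w) (hg : GradientBound w g) {t : ℝ}
    (ht : t ∈ Ioc (0 : ℝ) 1) : 2 * g 1 ≤ 2 * g t + 4 - Real.log t := by
  set G : ℝ → ℝ := fun s => 2 * g s + 2 * (s * deriv w s / w s) - Real.log s
  have hG : ∀ s ∈ Icc t 1, HasDerivAt G (2 * deriv g s + 2 * ((s * deriv w s / w s *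
      (1 - s * deriv w s / w s) + s ^ 2 * (deriv (deriv w) s / w s)) / s) - s⁻¹) s := by
    intro s hs
    have hs0 : 0 < s := ht.1.trans_le hs.1
    exact (((hg.differentiable s).hasDerivAt.const_mul 2).add
      ((hw.hasDerivAt_logDeriv ⟨hs0, by linarith [hs.2]⟩).const_mul 2)).sub
      (Real.hasDerivAt_log hs0.ne')
  have hanti : AntitoneOn G (Icc t 1) := by
    refine antitoneOn_of_deriv_nonpos (convex_Icc t 1)
      (fun s hs => (hG s hs).continuousAt.continuousWithinAt)
      (fun s hs => (hG s (interior_subset hs)).differentiableAt.differentiableWithinAt)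
      fun s hs => ?_
    have hs' := interior_subset hs
    have hs0 : 0 < s := ht.1.trans_le hs'.1
    rw [(hG s hs').deriv]
    have hb := (abs_le.1 (hg.two_mul_abs_deriv_le (t := s) ⟨hs0, by linarith [hs'.2]⟩)).2
    set q := s * deriv w s / w s
    set P := s ^ 2 * (deriv (deriv w) s / w s)
    have : 2 * deriv g s + 2 * ((q * (1 - q) + P) / s) - s⁻¹
        = (2 * (s * deriv g s) + 2 * (q * (1 - q) + P) - 1) / s := by
      field_simp
    rw [this]
    exact div_nonpos_of_nonpos_of_nonneg (by nlinarith [sq_nonneg (q - 1 / 2)]) hs0.le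
  have h := hanti ⟨le_rfl, ht.2⟩ ⟨ht.2, le_rfl⟩ ht.2
  simp only [G, Real.log_one] at h
  linarith [hw.logDeriv_le_one ht, hw.neg_one_le_logDeriv_one]

theorem exp_two_mul_mul_le (hw : WarpingProfile w) (hg : GradientBound w g) {t : ℝ}
    (ht : t ∈ Ioc (0 : ℝ) 1) :
    Real.exp (2 * g t) * w t ≤ Real.exp (2 * g 1 + 4) * w 1 * t ^ (-(5 / 8) : ℝ) := by
  set G : ℝ → ℝ := fun s =>
    2 * g s + Real.log (w s) - 2 * (s * deriv w s / w s) + 5 / 8 * Real.log s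
  have hG : ∀ s ∈ Icc t 1, HasDerivAt G (2 * deriv g s + deriv w s / w s -
      2 * ((s * deriv w s / w s * (1 - s * deriv w s / w s) +
        s ^ 2 * (deriv (deriv w) s / w s)) / s) + 5 / 8 * s⁻¹) s := by
    intro s hs
    have hs0 : 0 < s := ht.1.trans_le hs.1
    have hs2 : s ∈ Ioo (0 : ℝ) 2 := ⟨hs0, by linarith [hs.2]⟩
    exact ((((hg.differentiable s).hasDerivAt.const_mul 2).add
      ((hw.differentiable s).hasDerivAt.log (hw.pos s hs2).ne')).sub
      ((hw.hasDerivAt_logDeriv hs2).const_mul 2)).add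
      ((Real.hasDerivAt_log hs0.ne').const_mul (5 / 8))
  have hmono : MonotoneOn G (Icc t 1) := by
    refine monotoneOn_of_deriv_nonneg (convex_Icc t 1)
      (fun s hs => (hG s hs).continuousAt.continuousWithinAt)
      (fun s hs => (hG s (interior_subset hs)).differentiableAt.differentiableWithinAt)
      fun s hs => ?_
    have hs' := interior_subset hs
    have hs0 : 0 < s := ht.1.trans_le hs'.1
    rw [(hG s hs').deriv]
    have hb := (abs_le.1 (hg.two_mul_abs_deriv_le (t := s) ⟨hs0, by linarith [hs'.2]⟩)).1
    have hq : deriv w s / w s = s * deriv w s / w s / s := by field_simp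
    rw [hq]
    set q := s * deriv w s / w s
    set P := s ^ 2 * (deriv (deriv w) s / w s)
    have : 2 * deriv g s + q / s - 2 * ((q * (1 - q) + P) / s) + 5 / 8 * s⁻¹
        = (2 * (s * deriv g s) + q - 2 * (q * (1 - q) + P) + 5 / 8) / s := by
      field_simp
    rw [this]
    exact div_nonneg (by nlinarith [sq_nonneg (q - 1 / 4)]) hs0.le
  have h := hmono ⟨le_rfl, ht.2⟩ ⟨ht.2, le_rfl⟩ ht.2
  simp only [G, Real.log_one] at h
  have hwt := hw.pos t ⟨ht.1, by linarith [ht.2]⟩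
  have hw1 := hw.pos 1 (by norm_num)
  rw [Real.rpow_def_of_pos ht.1, ← Real.exp_log hwt, ← Real.exp_log hw1, ← Real.exp_add,
    ← Real.exp_add, ← Real.exp_add, Real.exp_le_exp]
  linarith [hw.logDeriv_le_one ht, hw.neg_one_le_logDeriv_one]

theorem half_le_integral_left (hw : WarpingProfile w) : w 1 / 2 ≤ ∫ t in (0 : ℝ)..1, w t := by
  have h : ∫ t in (0 : ℝ)..1, t * w 1 = w 1 / 2 := by
    rw [integral_mul_const, integral_id]
    ring
  rw [← h]
  exact integral_mono_on zero_le_one (by apply Continuous.intervalIntegrable; fun_prop)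
    (hw.differentiable.continuous.intervalIntegrable _ _) fun t ht => hw.mul_le ht

theorem integral_exp_left_le (hw : WarpingProfile w) (hg : GradientBound w g) :
    ∫ t in (0 : ℝ)..1, Real.exp (2 * g t) * w t ≤ 8 / 3 * (Real.exp (2 * g 1 + 4) * w 1) := by
  have h : ∫ t in (0 : ℝ)..1, Real.exp (2 * g 1 + 4) * w 1 * t ^ (-(5 / 8) : ℝ)
      = 8 / 3 * (Real.exp (2 * g 1 + 4) * w 1) := by
    rw [integral_const_mul, integral_rpow (Or.inl (by norm_num)), Real.one_rpow,
      Real.zero_rpow (by norm_num)]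
    ring
  rw [← h]
  have hgc := hg.differentiable.continuous
  have hwc := hw.differentiable.continuous
  refine integral_mono_on_of_le_Ioo zero_le_one
    (by apply Continuous.intervalIntegrable; fun_prop)
    ((intervalIntegrable_rpow' (by norm_num)).const_mul _)
    fun t ht => hw.exp_two_mul_mul_le hg ⟨ht.1, ht.2.le⟩

theorem half_le_integral_mul_left (hw : WarpingProfile w) (hg : GradientBound w g)
    (h5 : 5 ≤ g 1) : w 1 / 2 ≤ ∫ t in (0 : ℝ)..1, g t * w t := by
  have hgc := hg.differentiable.continuous
  have hwc := hw.differentiable.continuous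
  have hwi : IntervalIntegrable w MeasureTheory.volume 0 1 := hwc.intervalIntegrable _ _
  have h : ∫ t in (0 : ℝ)..1, (3 * w t + w 1 * Real.log t)
      = 3 * (∫ t in (0 : ℝ)..1, w t) - w 1 := by
    rw [integral_add (hwi.const_mul 3) (intervalIntegrable_log'.const_mul _), integral_const_mul,
      integral_const_mul, integral_log]
    simp
    ring
  calc w 1 / 2 ≤ ∫ t in (0 : ℝ)..1, (3 * w t + w 1 * Real.log t) := by
        rw [h]
        linarith [hw.half_le_integral_left]
    _ ≤ _ := by
        refine integral_mono_on_of_le_Ioo zero_le_one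
          ((hwi.const_mul 3).add (intervalIntegrable_log'.const_mul _))
          (by apply Continuous.intervalIntegrable; fun_prop) fun t ht => ?_
        have h1 := hw.two_mul_le_add_log hg ⟨ht.1, ht.2.le⟩
        have h2 := hw.le_two_mul ⟨ht.1.le, ht.2.le⟩
        have h3 := hw.pos t ⟨ht.1, by linarith [ht.2]⟩
        have h4 := Real.log_nonpos ht.1.le ht.2.le
        nlinarith

theorem integral_eq_left_add_reflect {F : ℝ → ℝ} (hF : Continuous F) :
    ∫ t in (0 : ℝ)..2, F t = (∫ t in (0 : ℝ)..1, F t) + ∫ t in (0 : ℝ)..1, F (2 - t) := by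
  rw [integral_comp_sub_left, ← integral_add_adjacent_intervals (hF.intervalIntegrable 0 1)
    (hF.intervalIntegrable 1 2)]
  norm_num

theorem le_integral (hw : WarpingProfile w) : w 1 ≤ ∫ t in (0 : ℝ)..2, w t := by
  rw [integral_eq_left_add_reflect hw.differentiable.continuous]
  have h := hw.reflect.half_le_integral_left
  rw [show (2 : ℝ) - 1 = 1 by norm_num] at h
  linarith [hw.half_le_integral_left]

theorem integral_exp_le (hw : WarpingProfile w) (hg : GradientBound w g) :
    ∫ t in (0 : ℝ)..2, Real.exp (2 * g t) * w t ≤ 16 / 3 * (Real.exp (2 * g 1 + 4) * w 1) := by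
  have hgc := hg.differentiable.continuous
  have hwc := hw.differentiable.continuous
  rw [integral_eq_left_add_reflect (by fun_prop)]
  have h := hw.reflect.integral_exp_left_le hg.reflect
  rw [show (2 : ℝ) - 1 = 1 by norm_num] at h
  linarith [hw.integral_exp_left_le hg]

theorem le_integral_mul (hw : WarpingProfile w) (hg : GradientBound w g)
    (h5 : 5 ≤ g 1) : w 1 ≤ ∫ t in (0 : ℝ)..2, g t * w t := by
  have hgc := hg.differentiable.continuous
  have hwc := hw.differentiable.continuous
  rw [integral_eq_left_add_reflect (by fun_prop)]
  have h := hw.reflect.half_le_integral_mul_left hg.reflect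
  rw [show (2 : ℝ) - 1 = 1 by norm_num] at h
  linarith [hw.half_le_integral_mul_left hg h5, h h5]

theorem abs_sub_le (hw : WarpingProfile w) (hg : GradientBound w g) {t : ℝ}
    (ht : t ∈ Icc (1 / 2 : ℝ) 1) : |g t - g 1| ≤ 5 / 2 := by
  have ht0 : 0 < t := by linarith [ht.1]
  have h1 := hw.two_mul_le_add_log hg ⟨ht0, ht.2⟩
  have h2 := hw.two_mul_le_add_log hg.neg ⟨ht0, ht.2⟩
  have h3 : -1 ≤ Real.log t := by
    have := Real.one_sub_inv_le_log_of_pos ht0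
    have : t⁻¹ ≤ 2 := by
      rw [inv_le_comm₀ ht0 two_pos]
      linarith [ht.1]
    linarith
  rw [abs_le]
  constructor <;> linarith

/-- Some latitude near the equator has `-w'' ≤ 4`, by the mean value theorem. -/
theorem exists_neg_deriv_deriv_le (hw : WarpingProfile w) (hle : ∀ t ∈ Icc (0 : ℝ) 2, w t ≤ t) :
    ∃ c ∈ Ioo (1 / 2 : ℝ) 1, -deriv (deriv w) c ≤ 4 := by
  obtain ⟨c, hc, h⟩ := exists_deriv_eq_slope (deriv w) (a := 1 / 2) (b := 1) (by norm_num)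
    hw.differentiable_deriv.continuous.continuousOn hw.differentiable_deriv.differentiableOn
  refine ⟨c, hc, ?_⟩
  rw [h, show (1 : ℝ) - 1 / 2 = 1 / 2 by norm_num]
  linarith [hw.mul_deriv_le (t := 1 / 2) (by norm_num), hle (1 / 2) (by norm_num),
    hle 1 (by norm_num), hw.neg_le_deriv_one]

end WarpingProfile

/-- Under the hypotheses on `w` and `f` (smoothness, concavity,
boundary conditions, positivity of `w` on `(0,2)`, periodicity, gradient
inequality, and mean-zero condition), the ratio of weighted integrals satisfies
`∫₀^{2π} ∫₀² e^{2f}·w ≤ 200·e^{100} · ∫₀^{2π} ∫₀² e^{f}·w`. -/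
theorem weighted_integral_ratio_bound (w : ℝ → ℝ) (f : ℝ → ℝ → ℝ)
    (hw : ContDiff ℝ (⊤ : ℕ∞) w)
    (hconc : ConcaveOn ℝ (Set.Icc 0 2) w)
    (h0 : w 0 = 0) (h2 : w 2 = 0)
    (hd0 : deriv w 0 = 1) (hd2 : deriv w 2 = -1)
    (hwpos : ∀ t ∈ Set.Ioo (0 : ℝ) 2, 0 < w t)
    (hf : ContDiff ℝ (⊤ : ℕ∞) (Function.uncurry f))
    (hper : ∀ t θ : ℝ, f t (θ + 2 * Real.pi) = f t θ)
    (hgrad : ∀ t ∈ Set.Ioo (0 : ℝ) 2, ∀ θ : ℝ,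
      (deriv (fun s => f s θ) t) ^ 2 + ((w t) ^ 2)⁻¹ * (deriv (fun s => f t s) θ) ^ 2
        ≤ -(deriv (deriv w) t) / w t)
    (hmean : (∫ θ in (0 : ℝ)..(2 * Real.pi), ∫ t in (0 : ℝ)..2, f t θ * w t) = 0) :
    (∫ θ in (0 : ℝ)..(2 * Real.pi), ∫ t in (0 : ℝ)..2, Real.exp (2 * f t θ) * w t)
      ≤ 200 * Real.exp 100 *
        (∫ θ in (0 : ℝ)..(2 * Real.pi), ∫ t in (0 : ℝ)..2, Real.exp (f t θ) * w t) := by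
  have hW : WarpingProfile w :=
    ⟨contDiff_infty.1 hw 2, hconc, h0, h2, hwpos⟩
  have hfd : Differentiable ℝ (Function.uncurry f) := hf.differentiable (by simp)
  have hfc : Continuous (Function.uncurry f) := hfd.continuous
  have hwc : Continuous w := hw.continuous
  have hg : ∀ θ, GradientBound w (fun t => f t θ) := fun θ =>
    ⟨hfd.comp (f := fun t : ℝ => (t, θ)) (by fun_prop), fun t ht =>
      le_trans (le_add_of_nonneg_right (by positivity)) (hgrad t ht θ)⟩
  have hw1 : 0 < w 1 := hwpos 1 (by norm_num)
  have hpi := Real.pi_pos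
  have hfcs : Continuous fun p : ℝ × ℝ => f p.2 p.1 := hfc.comp continuous_swap
  have hfi : Continuous fun θ => ∫ t in (0 : ℝ)..2, f t θ * w t :=
    continuous_parametric_intervalIntegral_of_continuous'
      (f := fun θ t => f t θ * w t) (hfcs.mul (hwc.comp continuous_snd)) 0 2
  have hei : Continuous fun θ => ∫ t in (0 : ℝ)..2, Real.exp (f t θ) * w t :=
    continuous_parametric_intervalIntegral_of_continuous' (f := fun θ t => Real.exp (f t θ) * w t)
      (hfcs.rexp.mul (hwc.comp continuous_snd)) 0 2
  have he2i : Continuous fun θ => ∫ t in (0 : ℝ)..2, Real.exp (2 * f t θ) * w t :=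
    continuous_parametric_intervalIntegral_of_continuous'
      (f := fun θ t => Real.exp (2 * f t θ) * w t)
      ((hfcs.const_mul 2).rexp.mul (hwc.comp continuous_snd)) 0 2
  have hconst : ∀ c : ℝ, ∫ _ in (0 : ℝ)..(2 * Real.pi), c = 2 * Real.pi * c := by
    intro c
    simp
  obtain ⟨θ₀, hθ₀, hlow⟩ : ∃ θ₀ ∈ Icc 0 (2 * Real.pi), f 1 θ₀ < 5 := by
    by_contra! hcon
    have : ∫ _ in (0 : ℝ)..(2 * Real.pi), w 1
        ≤ ∫ θ in (0 : ℝ)..(2 * Real.pi), ∫ t in (0 : ℝ)..2, f t θ * w t :=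
      integral_mono_on (by positivity) (continuous_const.intervalIntegrable _ _)
        (hfi.intervalIntegrable _ _) fun θ hθ => hW.le_integral_mul (hg θ) (hcon θ hθ)
    rw [hmean, hconst] at this
    nlinarith [mul_pos hpi hw1]
  have hwle : ∀ t ∈ Icc (0 : ℝ) 2, w t ≤ t := by
    intro t ht
    have := hconc.le_tangent hW.differentiable (x := 0) (by norm_num) ht
    rw [h0, hd0] at this
    linarith
  obtain ⟨c, hc, hc4⟩ := hW.exists_neg_deriv_deriv_le hwle
  have hc2 : c ∈ Ioo (0 : ℝ) 2 := ⟨by linarith [hc.1], by linarith [hc.2]⟩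
  have hdθ : ∀ θ, ‖deriv (fun s => f c s) θ‖ ≤ 2 := by
    intro θ
    have hwpc := hwpos c hc2
    have h1 := hgrad c hc2 θ
    have h3 : ((w c) ^ 2)⁻¹ * (deriv (fun s => f c s) θ) ^ 2 ≤ -(deriv (deriv w) c) / w c := by
      linarith [sq_nonneg (deriv (fun s => f s θ) c)]
    have h4 : (deriv (fun s => f c s) θ) ^ 2 ≤ -(deriv (deriv w) c) * w c := by
      rw [inv_mul_le_iff₀ (by positivity)] at h3
      refine h3.trans_eq ?_
      field_simp
    rw [Real.norm_eq_abs]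
    refine abs_le_of_sq_le_sq (h4.trans ?_) zero_le_two
    nlinarith [hwle c ⟨hc2.1.le, hc2.2.le⟩, hc.2]
  have hup : ∀ θ ∈ Icc 0 (2 * Real.pi), f 1 θ ≤ 26 := by
    intro θ hθ
    have hosc := (convex_univ (𝕜 := ℝ)).norm_image_sub_le_of_norm_deriv_le
      (f := fun s => f c s) (fun s _ => (hfd.comp (f := fun s : ℝ => (c, s)) (by fun_prop)) s)
      (fun s _ => hdθ s) (mem_univ θ₀) (mem_univ θ)
    rw [Real.norm_eq_abs, Real.norm_eq_abs] at hosc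
    have hdist : |θ - θ₀| ≤ 2 * Real.pi := by
      rw [abs_le]
      constructor <;> linarith [hθ.1, hθ.2, hθ₀.1, hθ₀.2]
    have h1 := (abs_le.1 (hW.abs_sub_le (hg θ) ⟨hc.1.le, hc.2.le⟩)).1
    have h3 := (abs_le.1 (hW.abs_sub_le (hg θ₀) ⟨hc.1.le, hc.2.le⟩)).2
    have h4 := (le_abs_self _).trans hosc
    linarith [Real.pi_le_four]
  have hupper : (∫ θ in (0 : ℝ)..(2 * Real.pi), ∫ t in (0 : ℝ)..2, Real.exp (2 * f t θ) * w t)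
      ≤ 2 * Real.pi * (200 * Real.exp 100 * w 1) := by
    rw [← hconst]
    refine integral_mono_on (by positivity) (he2i.intervalIntegrable _ _)
      (continuous_const.intervalIntegrable _ _) fun θ hθ => (hW.integral_exp_le (hg θ)).trans ?_
    have h1 : Real.exp (2 * f 1 θ + 4) ≤ Real.exp 100 :=
      Real.exp_le_exp.2 (by linarith [hup θ hθ])
    have h3 := mul_le_mul_of_nonneg_right h1 hw1.le
    have h4 := mul_pos (Real.exp_pos 100) hw1
    linarith
  have hlower : 2 * Real.pi * w 1
      ≤ ∫ θ in (0 : ℝ)..(2 * Real.pi), ∫ t in (0 : ℝ)..2, Real.exp (f t θ) * w t := by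
    calc 2 * Real.pi * w 1
        = ∫ θ in (0 : ℝ)..(2 * Real.pi), (w 1 + ∫ t in (0 : ℝ)..2, f t θ * w t) := by
          rw [integral_add (continuous_const.intervalIntegrable _ _)
            (hfi.intervalIntegrable _ _), hmean, hconst, add_zero]
      _ ≤ _ := by
          refine integral_mono_on (by positivity)
            ((continuous_const.add hfi).intervalIntegrable _ _) (hei.intervalIntegrable _ _)
            fun θ _ => ?_
          have hfθ : Continuous fun t => f t θ := (hg θ).differentiable.continuous
          calc w 1 + ∫ t in (0 : ℝ)..2, f t θ * w t
              ≤ (∫ t in (0 : ℝ)..2, w t) + ∫ t in (0 : ℝ)..2, f t θ * w t := by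
                linarith [hW.le_integral]
            _ = ∫ t in (0 : ℝ)..2, (w t + f t θ * w t) :=
                (integral_add (hwc.intervalIntegrable _ _)
                  ((hfθ.mul hwc).intervalIntegrable _ _)).symm
            _ ≤ _ := by
                refine integral_mono_on_of_le_Ioo zero_le_two
                  ((hwc.add (hfθ.mul hwc)).intervalIntegrable _ _)
                  ((hfθ.rexp.mul hwc).intervalIntegrable _ _) fun t ht => ?_
                nlinarith [Real.add_one_le_exp (f t θ), hwpos t ht]
  calc _ ≤ _ := hupper
    _ = 200 * Real.exp 100 * (2 * Real.pi * w 1) := by ring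
    _ ≤ _ := mul_le_mul_of_nonneg_left hlower (by positivity)
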